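/- arXiv:1309.4505 — 4 statements merged into one kernel-verified Lean document; each statement's English description precedes it below -/
import Mathlib

section
/- Let n ≥ 1 and t > 0. For every measurable function b : ℝⁿ₊ → ℝ with ∫_{ℝⁿ₊} yₙ |b(y)| dy < ∞ and every x ∈ ℝⁿ₊, the double integral ∫_{ℝⁿ₊} ∫_{−1}^{1} ∂_{xₙ}G_t(x′−y′, xₙ−s·yₙ) · (−yₙ) · b(y) ds dy converges absolutely and equals E(t)b(x). -/
open MeasureTheory ENNReal

noncomputable section

/-- Points of `ℝⁿ` with `n = m + 1`, written as pairs `x = (x′, xₙ)`. -/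
abbrev HalfSpacePt (m : ℕ) := (Fin m → ℝ) × ℝ

/-- The Gauss kernel `G_t(x) = (4πt)^{-n/2} exp(-|x|²/(4t))` in dimension `n = m + 1`. -/
def gauss (m : ℕ) (t : ℝ) (x : HalfSpacePt m) : ℝ :=
  (4 * Real.pi * t) ^ (-((m : ℝ) + 1) / 2) *
    Real.exp (-((∑ i, x.1 i ^ 2) + x.2 ^ 2) / (4 * t))

/-- The open upper half-space `ℝⁿ₊ = {x : xₙ > 0}`. -/
def halfSpace (m : ℕ) : Set (HalfSpacePt m) := {x | 0 < x.2}

/-- The Dirichlet heat operator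
`E(t)f(x) = ∫_{ℝⁿ₊} [G_t(x′−y′, xₙ−yₙ) − G_t(x′−y′, xₙ+yₙ)] f(y) dy`. -/
def Eheat (m : ℕ) (t : ℝ) (f : HalfSpacePt m → ℝ) (x : HalfSpacePt m) : ℝ :=
  ∫ y in halfSpace m,
    (gauss m t (x.1 - y.1, x.2 - y.2) - gauss m t (x.1 - y.1, x.2 + y.2)) * f y

/-- The Neumann heat operator
`F(t)f(x) = ∫_{ℝⁿ₊} [G_t(x′−y′, xₙ−yₙ) + G_t(x′−y′, xₙ+yₙ)] f(y) dy`. -/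
def Fheat (m : ℕ) (t : ℝ) (f : HalfSpacePt m → ℝ) (x : HalfSpacePt m) : ℝ :=
  ∫ y in halfSpace m,
    (gauss m t (x.1 - y.1, x.2 - y.2) + gauss m t (x.1 - y.1, x.2 + y.2)) * f y

/-- The Neumann potential operator `𝒩f(x) = ∫₀^∞ F(τ)f(x) dτ`. -/
def neumannPotential (m : ℕ) (f : HalfSpacePt m → ℝ) (x : HalfSpacePt m) : ℝ :=
  ∫ τ in Set.Ioi (0 : ℝ), Fheat m τ f x

/-- `∂_{xₙ} G_t`, the partial derivative of the Gauss kernel in the last coordinate. -/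
def gaussDn (m : ℕ) (t : ℝ) (z : HalfSpacePt m) : ℝ :=
  deriv (fun w => gauss m t (z.1, w)) z.2

/-- The `i`-th standard coordinate vector of `ℝⁿ`, `n = m + 1` (the case `i = n`
being the inward normal direction `eₙ`). -/
def coordVec (m : ℕ) (i : Fin (m + 1)) : HalfSpacePt m :=
  if h : (i : ℕ) < m then (Pi.single ⟨i, h⟩ 1, 0) else (0, 1)

theorem hasDerivAt_gauss (m : ℕ) (t : ℝ) (z : Fin m → ℝ) (w : ℝ) :
    HasDerivAt (fun w => gauss m t (z, w)) (-(w / (2 * t)) * gauss m t (z, w)) w := by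
  have h : HasDerivAt (fun w : ℝ => -((∑ i, z i ^ 2) + w ^ 2) / (4 * t)) (-(2 * w) / (4 * t)) w := by
    simpa using (((hasDerivAt_pow 2 w).const_add (∑ i, z i ^ 2)).neg.div_const (4 * t))
  have e : -(2 * w) / (4 * t) = -(w / (2 * t)) := by
    rw [show 4 * t = 2 * (2 * t) by ring, neg_div, mul_div_mul_left _ _ two_ne_zero]
  rw [e] at h
  refine (h.exp.const_mul ((4 * Real.pi * t) ^ (-((m : ℝ) + 1) / 2))).congr_deriv ?_
  rw [gauss]
  ring

theorem gaussDn_eq (m : ℕ) (t : ℝ) (z : HalfSpacePt m) :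
    gaussDn m t z = -(z.2 / (2 * t)) * gauss m t z :=
  (hasDerivAt_gauss m t z.1 z.2).deriv

theorem continuous_gauss (m : ℕ) (t : ℝ) : Continuous (gauss m t) := by
  unfold gauss
  fun_prop

theorem continuous_gaussDn (m : ℕ) (t : ℝ) : Continuous (gaussDn m t) := by
  rw [show gaussDn m t = fun z => -(z.2 / (2 * t)) * gauss m t z from funext (gaussDn_eq m t)]
  have := continuous_gauss m t
  fun_prop

theorem exists_abs_gaussDn_le (m : ℕ) {t : ℝ} (ht : 0 < t) :
    ∃ K, ∀ z, |gaussDn m t z| ≤ K := by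
  set C := (4 * Real.pi * t) ^ (-((m : ℝ) + 1) / 2) with hC
  have hC0 : 0 ≤ C := by positivity
  refine ⟨(1 + t) / (2 * t) * C, fun z => ?_⟩
  have hexp : Real.exp (-((∑ i, z.1 i ^ 2) + z.2 ^ 2) / (4 * t))
      ≤ Real.exp (-(z.2 ^ 2 / (4 * t))) := by
    have : 0 ≤ ∑ i, z.1 i ^ 2 := Finset.sum_nonneg fun i _ => sq_nonneg _
    rw [← neg_div]
    gcongr
    linarith
  have hw : |z.2| ≤ (1 + t) * Real.exp (z.2 ^ 2 / (4 * t)) := by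
    have h1 : |z.2| ≤ t + z.2 ^ 2 / (4 * t) := by
      rw [← sq_abs, ← sub_nonneg,
        show t + |z.2| ^ 2 / (4 * t) - |z.2| = (2 * t - |z.2|) ^ 2 / (4 * t) by field_simp; ring]
      positivity
    have h2 := Real.add_one_le_exp (z.2 ^ 2 / (4 * t))
    have h3 : 0 ≤ z.2 ^ 2 / (4 * t) := by positivity
    nlinarith
  have hz : |z.2| * Real.exp (-((∑ i, z.1 i ^ 2) + z.2 ^ 2) / (4 * t)) ≤ 1 + t := by
    calc _ ≤ (1 + t) * Real.exp (z.2 ^ 2 / (4 * t)) * Real.exp (-(z.2 ^ 2 / (4 * t))) := by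
          gcongr
      _ = 1 + t := by rw [mul_assoc, ← Real.exp_add]; simp
  rw [gaussDn_eq, gauss, ← hC, abs_mul, abs_neg, abs_div, abs_mul C, abs_of_nonneg hC0,
    Real.abs_exp, abs_of_pos (by positivity : 0 < 2 * t)]
  calc _ = |z.2| * Real.exp (-((∑ i, z.1 i ^ 2) + z.2 ^ 2) / (4 * t)) / (2 * t) * C := by ring
    _ ≤ _ := by gcongr

theorem setIntegral_gaussDn (m : ℕ) (t : ℝ) (z : Fin m → ℝ) (a c : ℝ) :
    ∫ s in Set.Ioo (-1 : ℝ) 1, gaussDn m t (z, a - s * c) * (-c)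
      = gauss m t (z, a - c) - gauss m t (z, a + c) := by
  have hd : ∀ s ∈ Set.uIcc (-1 : ℝ) 1, HasDerivAt (fun s => gauss m t (z, a - s * c))
      (gaussDn m t (z, a - s * c) * (-c)) s := fun s _ => by
    have h1 : HasDerivAt (fun s : ℝ => a - s * c) (-c) s := by
      simpa using ((hasDerivAt_id s).mul_const c).const_sub a
    have h2 := (hasDerivAt_gauss m t z (a - s * c)).comp s h1
    rwa [← gaussDn_eq m t (z, a - s * c)] at h2
  have hc : Continuous fun s : ℝ => gaussDn m t (z, a - s * c) * (-c) := by
    have := continuous_gaussDn m t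
    fun_prop
  rw [← integral_Ioc_eq_integral_Ioo, ← intervalIntegral.integral_of_le (by norm_num),
    intervalIntegral.integral_eq_sub_of_hasDerivAt hd (hc.intervalIntegrable _ _)]
  simp

/-- for `t > 0` and `b` measurable on `ℝⁿ₊` with `∫ yₙ |b(y)| dy < ∞`,
for every `x ∈ ℝⁿ₊` the double integral
`∫_{ℝⁿ₊} ∫_{−1}^{1} ∂_{xₙ}G_t(x′−y′, xₙ−s·yₙ) ·(−yₙ)· b(y) ds dy`
converges absolutely and equals `E(t)b(x)`. -/
theorem Eheat_eq_doubleIntegral (m : ℕ) (t : ℝ) (ht : 0 < t) (b : HalfSpacePt m → ℝ)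
    (hb : Measurable b)
    (hbm : (∫⁻ y in halfSpace m, ENNReal.ofReal (y.2 * |b y|)) < ⊤)
    (x : HalfSpacePt m) (hx : x ∈ halfSpace m) :
    IntegrableOn
      (fun p : HalfSpacePt m × ℝ =>
        gaussDn m t (x.1 - p.1.1, x.2 - p.2 * p.1.2) * (-p.1.2) * b p.1)
      (halfSpace m ×ˢ Set.Ioo (-1 : ℝ) 1) volume ∧
    Eheat m t b x =
      ∫ y in halfSpace m, ∫ s in Set.Ioo (-1 : ℝ) 1,
        gaussDn m t (x.1 - y.1, x.2 - s * y.2) * (-y.2) * b y := by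
  constructor
  · obtain ⟨K, hK⟩ := exists_abs_gaussDn_le m ht
    have hH : MeasurableSet (halfSpace m) := measurableSet_lt measurable_const measurable_snd
    have hint : Integrable (fun y : HalfSpacePt m => y.2 * |b y|)
        (volume.restrict (halfSpace m)) := by
      refine ⟨by fun_prop, ?_⟩
      rwa [hasFiniteIntegral_iff_ofReal]
      filter_upwards [ae_restrict_mem hH] with y hy
      exact mul_nonneg (le_of_lt hy) (abs_nonneg _)
    rw [IntegrableOn, Measure.volume_eq_prod, ← Measure.prod_restrict]
    refine ((hint.comp_fst (volume.restrict (Set.Ioo (-1 : ℝ) 1))).const_mul K).mono ?_ ?_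
    · have hg := (continuous_gaussDn m t).measurable
      exact Measurable.aestronglyMeasurable (by fun_prop)
    · refine .of_forall fun p => ?_
      simp only [norm_mul, Real.norm_eq_abs, abs_neg, abs_abs, ← mul_assoc]
      exact mul_le_mul_of_nonneg_right (mul_le_mul_of_nonneg_right
        ((hK _).trans (le_abs_self K)) (abs_nonneg _)) (abs_nonneg _)
  · simp_rw [Eheat, integral_mul_const (b _), setIntegral_gaussDn]

end
end

section
/- Let n ≥ 1 and 1 ≤ q ≤ ∞. There exists a constant C = C(n, q) > 0 such that for every t > 0 and every measurable function b : ℝⁿ₊ → ℝ with ∫_{ℝⁿ₊} yₙ |b(y)| dy < ∞, one has ‖E(t)b‖_{L^q(ℝⁿ₊)} ≤ C t^{−1/2 − (n/2)(1 − 1/q)} ∫_{ℝⁿ₊} yₙ |b(y)| dy (with the L^∞ norm taken as the essential supremum when q = ∞). -/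
open MeasureTheory ENNReal

noncomputable section

lemma setIntegral_Ioi_zero_comp_add_right (g : ℝ → ℝ) (a : ℝ) :
    ∫ x in Set.Ioi 0, g (x + a) = ∫ x in Set.Ioi a, g x := by
  have h := (measurePreserving_add_right volume a).setIntegral_preimage_emb
    (measurableEmbedding_addRight a) g (Set.Ioi a)
  simpa using h

/-- The function `v ↦ exp (-v ^ 2)` is `1`-Lipschitz. -/
lemma abs_exp_neg_sq_sub_exp_neg_sq_le (u v : ℝ) :
    |Real.exp (-u ^ 2) - Real.exp (-v ^ 2)| ≤ |u - v| := by
  have hd (w : ℝ) :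
      HasDerivAt (fun w : ℝ => Real.exp (-w ^ 2)) (Real.exp (-w ^ 2) * (-(2 * w))) w := by
    simpa using ((hasDerivAt_pow 2 w).neg).exp
  have key := Convex.norm_image_sub_le_of_norm_deriv_le (𝕜 := ℝ) (s := Set.univ) (C := 1)
    (f := fun w : ℝ => Real.exp (-w ^ 2)) (x := v) (y := u)
    (fun w _ => (hd w).differentiableAt) (fun w _ => ?_) convex_univ trivial trivial
  · simpa using key
  · rw [(hd w).deriv, norm_mul, norm_neg, Real.norm_eq_abs, Real.norm_eq_abs, Real.abs_exp,
      Real.exp_neg, inv_mul_le_iff₀ (Real.exp_pos _)]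
    have h1 : w ^ 2 + 1 ≤ Real.exp (w ^ 2) := Real.add_one_le_exp _
    have h2 : |2 * w| ≤ w ^ 2 + 1 := by
      rw [abs_le]; constructor <;> nlinarith [sq_nonneg (w - 1), sq_nonneg (w + 1)]
    linarith

lemma integrable_exp_neg_sq_div {t : ℝ} (ht : 0 < t) :
    Integrable fun x : ℝ => Real.exp (-x ^ 2 / (4 * t)) := by
  refine (integrable_exp_neg_mul_sq (b := 1 / (4 * t)) (by positivity)).congr
    (.of_forall fun x => ?_)
  simp only; congr 1; ring

lemma integral_exp_neg_sq_div (t : ℝ) :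
    ∫ x : ℝ, Real.exp (-x ^ 2 / (4 * t)) = √(4 * Real.pi * t) := by
  rw [show 4 * Real.pi * t = Real.pi / (1 / (4 * t)) by rw [div_div_eq_mul_div]; ring,
    ← integral_gaussian]
  refine integral_congr_ae (.of_forall fun x => ?_)
  simp only; congr 1; ring

/-- The mass on the half-line of the Gaussian centred at `y` exceeds that of its reflection
by at most `2 * y`. -/
lemma integral_Ioi_exp_neg_sq_sub_le {t y : ℝ} (ht : 0 < t) (hy : 0 < y) :
    ∫ x in Set.Ioi 0, (Real.exp (-(x - y) ^ 2 / (4 * t)) - Real.exp (-(x + y) ^ 2 / (4 * t)))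
      ≤ 2 * y := by
  set g : ℝ → ℝ := fun x => Real.exp (-x ^ 2 / (4 * t)) with hg
  have hi : Integrable g := integrable_exp_neg_sq_div ht
  have h1 : ∫ x in Set.Ioi 0, (g (x + -y) - g (x + y)) = ∫ x in (-y)..y, g x := by
    rw [integral_sub (hi.comp_add_right _).integrableOn (hi.comp_add_right _).integrableOn,
      setIntegral_Ioi_zero_comp_add_right, setIntegral_Ioi_zero_comp_add_right,
      intervalIntegral.integral_Ioi_sub_Ioi hi.integrableOn (by linarith)]
  have h2 : ∫ x in (-y)..y, g x ≤ ∫ _ in (-y)..y, (1 : ℝ) := by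
    refine intervalIntegral.integral_mono_on (by linarith) hi.intervalIntegrable
      intervalIntegrable_const fun x _ => Real.exp_le_one_iff.2 ?_
    exact div_nonpos_of_nonpos_of_nonneg (by nlinarith [sq_nonneg x]) (by positivity)
  have h3 : ∫ _ in (-y)..y, (1 : ℝ) = 2 * y := by simp; ring
  simp only [hg] at h1 h2
  simp only [← sub_eq_add_neg] at h1
  linarith

/-- The Dirichlet heat kernel of the half-space. -/
def dirichletKernel (m : ℕ) (t : ℝ) (x y : HalfSpacePt m) : ℝ :=
  gauss m t (x.1 - y.1, x.2 - y.2) - gauss m t (x.1 - y.1, x.2 + y.2)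

lemma dirichletKernel_eq (m : ℕ) (t : ℝ) (x y : HalfSpacePt m) :
    dirichletKernel m t x y = (4 * Real.pi * t) ^ (-((m : ℝ) + 1) / 2) *
      ((∏ i, Real.exp (-(x.1 i - y.1 i) ^ 2 / (4 * t))) *
        (Real.exp (-(x.2 - y.2) ^ 2 / (4 * t)) - Real.exp (-(x.2 + y.2) ^ 2 / (4 * t)))) := by
  have h (s : ℝ) : Real.exp (-((∑ i, (x.1 i - y.1 i) ^ 2) + s ^ 2) / (4 * t)) =
      (∏ i, Real.exp (-(x.1 i - y.1 i) ^ 2 / (4 * t))) * Real.exp (-s ^ 2 / (4 * t)) := by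
    rw [← Real.exp_sum, ← Real.exp_add, ← Finset.sum_div, Finset.sum_neg_distrib]
    congr 1; ring
  simp only [dirichletKernel, gauss, Pi.sub_apply, h]
  ring

lemma continuous_dirichletKernel (m : ℕ) (t : ℝ) :
    Continuous fun p : HalfSpacePt m × HalfSpacePt m => dirichletKernel m t p.1 p.2 := by
  unfold dirichletKernel gauss
  fun_prop

lemma dirichletKernel_nonneg {m : ℕ} {t : ℝ} (ht : 0 < t) {x y : HalfSpacePt m}
    (hx : 0 < x.2) (hy : 0 < y.2) : 0 ≤ dirichletKernel m t x y := by
  rw [dirichletKernel_eq]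
  have : Real.exp (-(x.2 + y.2) ^ 2 / (4 * t)) ≤ Real.exp (-(x.2 - y.2) ^ 2 / (4 * t)) := by
    refine Real.exp_le_exp.2 ?_
    gcongr ?_ / _
    nlinarith [mul_pos hx hy]
  have := sub_nonneg.2 this
  positivity

lemma dirichletKernel_le {m : ℕ} {t : ℝ} (ht : 0 < t) {x y : HalfSpacePt m} (hy : 0 < y.2) :
    dirichletKernel m t x y ≤ t ^ (-(1 : ℝ) / 2 - ((m : ℝ) + 1) / 2) * y.2 := by
  rw [dirichletKernel_eq]
  have hs : 0 < √t := Real.sqrt_pos.2 ht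
  have hprod : ∏ i, Real.exp (-(x.1 i - y.1 i) ^ 2 / (4 * t)) ≤ 1 :=
    Finset.prod_le_one (fun _ _ => (Real.exp_pos _).le) fun i _ => Real.exp_le_one_iff.2
      (div_nonpos_of_nonpos_of_nonneg (by nlinarith [sq_nonneg (x.1 i - y.1 i)]) (by positivity))
  have hsq (s : ℝ) : -s ^ 2 / (4 * t) = -(s / (2 * √t)) ^ 2 := by
    rw [div_pow, mul_pow, Real.sq_sqrt ht.le]; ring
  have hdiff : |Real.exp (-(x.2 - y.2) ^ 2 / (4 * t)) - Real.exp (-(x.2 + y.2) ^ 2 / (4 * t))|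
      ≤ y.2 / √t := by
    rw [hsq, hsq]
    refine (abs_exp_neg_sq_sub_exp_neg_sq_le _ _).trans (le_of_eq ?_)
    rw [show (x.2 - y.2) / (2 * √t) - (x.2 + y.2) / (2 * √t) = -(y.2 / √t) by field_simp; ring,
      abs_neg, abs_of_pos (by positivity)]
  have hpow : (4 * Real.pi * t) ^ (-((m : ℝ) + 1) / 2) ≤ t ^ (-((m : ℝ) + 1) / 2) :=
    Real.rpow_le_rpow_of_nonpos ht (by nlinarith [Real.pi_gt_three])
      (div_nonpos_of_nonpos_of_nonneg (by have := m.cast_nonneg (α := ℝ); linarith) two_pos.le)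
  have hP : 0 ≤ ∏ i, Real.exp (-(x.1 i - y.1 i) ^ 2 / (4 * t)) := by positivity
  calc _ ≤ t ^ (-((m : ℝ) + 1) / 2) * (1 * (y.2 / √t)) := by
        refine (mul_le_mul_of_nonneg_left (mul_le_mul_of_nonneg_left
          ((le_abs_self _).trans hdiff) hP) (by positivity)).trans ?_
        gcongr
    _ = _ := by
        rw [Real.sqrt_eq_rpow, sub_eq_add_neg, Real.rpow_add ht, neg_div (2 : ℝ) 1,
          Real.rpow_neg ht.le, neg_div]
        ring

lemma lintegral_dirichletKernel_le {m : ℕ} {t : ℝ} (ht : 0 < t) {y : HalfSpacePt m}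
    (hy : 0 < y.2) :
    ∫⁻ x in halfSpace m, ENNReal.ofReal (dirichletKernel m t x y) ≤
      ENNReal.ofReal (t ^ (-(1 : ℝ) / 2) * y.2) := by
  have hset : halfSpace m = Set.univ ×ˢ Set.Ioi (0 : ℝ) := by ext; simp [halfSpace]
  have hi := integrable_exp_neg_sq_div ht
  have hP : Integrable fun x : Fin m → ℝ => ∏ i, Real.exp (-(x i - y.1 i) ^ 2 / (4 * t)) :=
    Integrable.fintype_prod (μ := fun _ => volume) fun i => hi.comp_sub_right (y.1 i)
  have hQ : IntegrableOn (fun x : ℝ => Real.exp (-(x - y.2) ^ 2 / (4 * t)) -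
      Real.exp (-(x + y.2) ^ 2 / (4 * t))) (Set.Ioi 0) :=
    ((hi.comp_sub_right y.2).sub (hi.comp_add_right y.2)).integrableOn
  have hPint : ∫ x : Fin m → ℝ, ∏ i, Real.exp (-(x i - y.1 i) ^ 2 / (4 * t)) =
      √(4 * Real.pi * t) ^ m := by
    rw [integral_fintype_prod_volume_eq_prod
      (fun i (v : ℝ) => Real.exp (-(v - y.1 i) ^ 2 / (4 * t)))]
    simp [integral_sub_right_eq_self (fun v : ℝ => Real.exp (-v ^ 2 / (4 * t))),
      integral_exp_neg_sq_div]
  have hint : IntegrableOn (fun x => dirichletKernel m t x y) (halfSpace m) := by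
    simp only [dirichletKernel_eq]
    rw [hset, IntegrableOn, Measure.volume_eq_prod, ← Measure.prod_restrict, Measure.restrict_univ]
    exact (hP.mul_prod hQ).const_mul _
  have hmeas : MeasurableSet (halfSpace m) := measurableSet_lt measurable_const measurable_snd
  rw [← ofReal_integral_eq_lintegral_ofReal hint
    (ae_restrict_of_forall_mem hmeas fun x hx => dirichletKernel_nonneg ht hx hy)]
  refine ENNReal.ofReal_le_ofReal ?_
  simp only [dirichletKernel_eq]
  rw [integral_const_mul, hset, Measure.volume_eq_prod,
    setIntegral_prod_mul (fun x : Fin m → ℝ => ∏ i, Real.exp (-(x i - y.1 i) ^ 2 / (4 * t)))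
      (fun x : ℝ => Real.exp (-(x - y.2) ^ 2 / (4 * t)) - Real.exp (-(x + y.2) ^ 2 / (4 * t))),
    setIntegral_univ, hPint]
  have hc : 0 < 4 * Real.pi * t := by positivity
  have hA : (4 * Real.pi * t) ^ (-((m : ℝ) + 1) / 2) * √(4 * Real.pi * t) ^ m =
      (4 * Real.pi * t) ^ (-(1 : ℝ) / 2) := by
    rw [Real.sqrt_eq_rpow, ← Real.rpow_mul_natCast hc.le, ← Real.rpow_add hc]
    congr 1; ring
  have hB : (4 * Real.pi * t) ^ (-(1 : ℝ) / 2) * 2 ≤ t ^ (-(1 : ℝ) / 2) := by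
    have h4 : (4 : ℝ) ^ (-(1 : ℝ) / 2) = 1 / 2 := by
      rw [show (4 : ℝ) = 2 ^ (2 : ℝ) by norm_num, ← Real.rpow_mul two_pos.le]
      norm_num
    rw [mul_assoc, Real.mul_rpow (by norm_num) (by positivity), h4]
    have := Real.rpow_le_rpow_of_nonpos (z := -(1 : ℝ) / 2) ht
      (show t ≤ Real.pi * t by nlinarith [Real.pi_gt_three]) (by norm_num)
    linarith
  rw [← mul_assoc, hA]
  calc _ ≤ (4 * Real.pi * t) ^ (-(1 : ℝ) / 2) * (2 * y.2) := by
        gcongr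
        exact integral_Ioi_exp_neg_sq_sub_le ht hy
    _ = (4 * Real.pi * t) ^ (-(1 : ℝ) / 2) * 2 * y.2 := by ring
    _ ≤ _ := by gcongr

/-- Interpolation between a pointwise bound and an `L¹` bound. -/
lemma eLpNorm_le_rpow_mul_rpow {α E : Type*} [MeasurableSpace α] [NormedAddCommGroup E]
    {μ : Measure α} {f : α → E} {q B D : ℝ≥0∞} (hq : 1 ≤ q)
    (hB : ∀ᵐ x ∂μ, ‖f x‖ₑ ≤ B) (hBt : B ≠ ⊤) (hD : ∫⁻ x, ‖f x‖ₑ ∂μ ≤ D) :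
    eLpNorm f q μ ≤ B ^ (1 - q⁻¹.toReal) * D ^ q⁻¹.toReal := by
  rcases eq_or_ne q ⊤ with rfl | hqt
  · simpa using eLpNormEssSup_le_of_ae_enorm_bound hB
  have hq0 : q ≠ 0 := (zero_lt_one.trans_le hq).ne'
  have hr : 1 ≤ q.toReal := by simpa using ENNReal.toReal_mono hqt hq
  rw [eLpNorm_eq_lintegral_rpow_enorm_toReal hq0 hqt, ENNReal.toReal_inv, one_div]
  set r := q.toReal
  have hr0 : 0 < r := by linarith
  have h : ∫⁻ x, ‖f x‖ₑ ^ r ∂μ ≤ B ^ (r - 1) * D := by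
    calc ∫⁻ x, ‖f x‖ₑ ^ r ∂μ ≤ ∫⁻ x, B ^ (r - 1) * ‖f x‖ₑ ∂μ := by
          refine lintegral_mono_ae (hB.mono fun x hx => ?_)
          have hs : ‖f x‖ₑ ^ r = ‖f x‖ₑ ^ (r - 1) * ‖f x‖ₑ := by
            nth_rw 3 [← ENNReal.rpow_one ‖f x‖ₑ]
            rw [← ENNReal.rpow_add_of_nonneg _ _ (by linarith) zero_le_one, sub_add_cancel]
          rw [hs]
          gcongr
      _ = B ^ (r - 1) * ∫⁻ x, ‖f x‖ₑ ∂μ :=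
          lintegral_const_mul' _ _ (ENNReal.rpow_ne_top_of_nonneg (by linarith) hBt)
      _ ≤ _ := by gcongr
  calc _ ≤ (B ^ (r - 1) * D) ^ r⁻¹ := by gcongr
    _ = _ := by
      rw [ENNReal.mul_rpow_of_nonneg _ _ (by positivity), ← ENNReal.rpow_mul]
      congr 2
      field_simp

/-- for `1 ≤ q ≤ ∞` there is `C = C(n,q) > 0` with
`‖E(t)b‖_{L^q(ℝⁿ₊)} ≤ C t^{−1/2 − (n/2)(1 − 1/q)} ∫_{ℝⁿ₊} yₙ|b(y)| dy` (`n = m + 1`). -/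
theorem Eheat_Lq_decay (m : ℕ) (q : ℝ≥0∞) (hq : 1 ≤ q) :
    ∃ C : ℝ, 0 < C ∧ ∀ t : ℝ, 0 < t → ∀ b : HalfSpacePt m → ℝ, Measurable b →
      (∫⁻ y in halfSpace m, ENNReal.ofReal (y.2 * |b y|)) < ⊤ →
      eLpNorm (Eheat m t b) q (volume.restrict (halfSpace m)) ≤
        ENNReal.ofReal
          (C * t ^ (-(1 : ℝ) / 2 - ((m : ℝ) + 1) / 2 * (1 - q⁻¹.toReal)) *
            ∫ y in halfSpace m, y.2 * |b y|) := by
  refine ⟨1, one_pos, fun t ht b hb hfin => ?_⟩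
  have hmeas : MeasurableSet (halfSpace m) := measurableSet_lt measurable_const measurable_snd
  have hnn : 0 ≤ᵐ[volume.restrict (halfSpace m)] fun y => y.2 * |b y| :=
    ae_restrict_of_forall_mem hmeas fun y hy => mul_nonneg (le_of_lt hy) (abs_nonneg _)
  have hint : IntegrableOn (fun y : HalfSpacePt m => y.2 * |b y|) (halfSpace m) :=
    (lintegral_ofReal_ne_top_iff_integrable (by fun_prop) hnn).1 hfin.ne
  have hM0 : 0 ≤ ∫ y in halfSpace m, y.2 * |b y| := integral_nonneg_of_ae hnn
  have hM := ofReal_integral_eq_lintegral_ofReal hint hnn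
  set M := ∫ y in halfSpace m, y.2 * |b y|
  have hpt : ∀ x ∈ halfSpace m, ‖Eheat m t b x‖ₑ ≤
      ∫⁻ y in halfSpace m, ENNReal.ofReal (dirichletKernel m t x y) * ‖b y‖ₑ := by
    intro x hx
    refine (enorm_integral_le_lintegral_enorm _).trans (setLIntegral_mono' hmeas fun y hy => ?_)
    rw [enorm_mul, ← Real.enorm_of_nonneg (dirichletKernel_nonneg ht hx hy), dirichletKernel]
  have hweight {a : ℝ} (ha : 0 ≤ a) (y : HalfSpacePt m) (hy : 0 < y.2) :
      ENNReal.ofReal (a * y.2) * ‖b y‖ₑ = ENNReal.ofReal a * ENNReal.ofReal (y.2 * |b y|) := by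
    rw [Real.enorm_eq_ofReal_abs, ENNReal.ofReal_mul ha, ENNReal.ofReal_mul hy.le, mul_assoc]
  have hB : ∀ᵐ x ∂volume.restrict (halfSpace m), ‖Eheat m t b x‖ₑ ≤
      ENNReal.ofReal (t ^ (-(1 : ℝ) / 2 - ((m : ℝ) + 1) / 2) * M) := by
    refine ae_restrict_of_forall_mem hmeas fun x hx => (hpt x hx).trans ?_
    rw [ENNReal.ofReal_mul (by positivity), hM, ← lintegral_const_mul' _ _ ENNReal.ofReal_ne_top]
    refine setLIntegral_mono' hmeas fun y hy => ?_
    rw [← hweight (by positivity) y hy]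
    gcongr
    exact dirichletKernel_le ht hy
  have hD : ∫⁻ x in halfSpace m, ‖Eheat m t b x‖ₑ ≤ ENNReal.ofReal (t ^ (-(1 : ℝ) / 2) * M) := by
    refine (setLIntegral_mono' hmeas hpt).trans ?_
    rw [lintegral_lintegral_swap (Measurable.aemeasurable
      ((continuous_dirichletKernel m t).measurable.ennreal_ofReal.mul (by fun_prop))),
      ENNReal.ofReal_mul (by positivity), hM, ← lintegral_const_mul' _ _ ENNReal.ofReal_ne_top]
    refine setLIntegral_mono' hmeas fun y hy => ?_
    rw [← hweight (by positivity) y hy, lintegral_mul_const' _ _ enorm_ne_top]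
    gcongr
    exact lintegral_dirichletKernel_le ht hy
  refine (eLpNorm_le_rpow_mul_rpow hq hB ENNReal.ofReal_ne_top hD).trans (le_of_eq ?_)
  have hθ0 : 0 ≤ q⁻¹.toReal := ENNReal.toReal_nonneg
  have hθ1 : q⁻¹.toReal ≤ 1 := by
    simpa using ENNReal.toReal_mono ENNReal.one_ne_top (ENNReal.inv_le_one.2 hq)
  set θ := q⁻¹.toReal
  rw [ENNReal.ofReal_rpow_of_nonneg (by positivity) (by linarith),
    ENNReal.ofReal_rpow_of_nonneg (by positivity) hθ0, ← ENNReal.ofReal_mul (by positivity),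
    Real.mul_rpow (by positivity) hM0, Real.mul_rpow (by positivity) hM0, mul_mul_mul_comm,
    ← Real.rpow_mul ht.le, ← Real.rpow_mul ht.le, ← Real.rpow_add ht,
    ← Real.rpow_add_of_nonneg hM0 (by linarith) hθ0, sub_add_cancel, Real.rpow_one, one_mul]
  congr 3
  ring

end
end

section
/- Let n ≥ 1 and 1 ≤ q ≤ ∞. There exists a constant C = C(n, q) > 0 such that for every t > 0 and every measurable function b : ℝⁿ₊ → ℝ with ∫_{ℝⁿ₊} yₙ |b(y)| dy < ∞, the function x ↦ E(t)b(x) is twice differentiable on ℝⁿ₊ and all of its second-order spatial partial derivatives satisfy ‖∂_i∂_j E(t)b‖_{L^q(ℝⁿ₊)} ≤ C t^{−3/2 − (n/2)(1 − 1/q)} ∫_{ℝⁿ₊} yₙ |b(y)| dy for all 1 ≤ i, j ≤ n. -/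
open MeasureTheory ENNReal

noncomputable section

set_option maxSynthPendingDepth 3

/-- Reflection of a point across the boundary of the half-space. -/
def reflectPt (m : ℕ) (y : HalfSpacePt m) : HalfSpacePt m := (y.1, -y.2)

theorem continuous_reflectPt (m : ℕ) : Continuous (reflectPt m) := by
  unfold reflectPt; fun_prop

theorem norm_reflectPt_sub (m : ℕ) {y : HalfSpacePt m} (hy : y ∈ halfSpace m) :
    ‖reflectPt m y - y‖ = 2 * y.2 := by
  have hy' : 0 < y.2 := hy
  have : reflectPt m y - y = (0, -(2 * y.2)) := by
    ext <;> simp [reflectPt]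
    ring
  rw [this, Prod.norm_mk, norm_zero, norm_neg, Real.norm_of_nonneg (by positivity)]
  exact max_eq_right (by positivity)

instance isAddHaarMeasure_volume (m : ℕ) :
    (volume : Measure (HalfSpacePt m)).IsAddHaarMeasure :=
  inferInstanceAs ((volume : Measure (Fin m → ℝ)).prod (volume : Measure ℝ)).IsAddHaarMeasure

theorem measurableSet_halfSpace (m : ℕ) : MeasurableSet (halfSpace m) :=
  measurableSet_lt measurable_const measurable_snd

/-- The integral over the half-space of `b(y) (h(x - y) - h(x - y*))`, where `y*` is the
reflection of `y`. -/
def dipole {F : Type*} [NormedAddCommGroup F] [NormedSpace ℝ F] (m : ℕ)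
    (b : HalfSpacePt m → ℝ) (h : HalfSpacePt m → F) (x : HalfSpacePt m) : F :=
  ∫ y in halfSpace m, b y • (h (x - y) - h (x - reflectPt m y))

section Dipole

variable {F : Type*} [NormedAddCommGroup F] [NormedSpace ℝ F] {m : ℕ} {b : HalfSpacePt m → ℝ}

theorem norm_smul_sub_reflectPt_le {h : HalfSpacePt m → F} (hh : Differentiable ℝ h) {A : ℝ}
    (hA : ∀ x, ‖fderiv ℝ h x‖ ≤ A) (x : HalfSpacePt m) {y : HalfSpacePt m}
    (hy : y ∈ halfSpace m) :
    ‖b y • (h (x - y) - h (x - reflectPt m y))‖ ≤ 2 * A * (y.2 * |b y|) := by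
  have key := convex_univ.norm_image_sub_le_of_norm_fderiv_le (𝕜 := ℝ) (fun z _ => hh z)
    (fun z _ => hA z) (Set.mem_univ (x - reflectPt m y)) (Set.mem_univ (x - y))
  have hsub : x - y - (x - reflectPt m y) = reflectPt m y - y := by abel
  rw [hsub, norm_reflectPt_sub m hy] at key
  rw [norm_smul, Real.norm_eq_abs]
  calc |b y| * ‖h (x - y) - h (x - reflectPt m y)‖ ≤ |b y| * (A * (2 * y.2)) := by gcongr
    _ = _ := by ring

theorem aestronglyMeasurable_smul_sub_reflectPt {h : HalfSpacePt m → F} (hh : Continuous h)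
    (hb : Measurable b) (x : HalfSpacePt m) (μ : Measure (HalfSpacePt m)) :
    AEStronglyMeasurable (fun y => b y • (h (x - y) - h (x - reflectPt m y))) μ := by
  have := continuous_reflectPt m
  exact hb.aestronglyMeasurable.smul (Continuous.aestronglyMeasurable (by fun_prop))

theorem norm_dipole_le {h : HalfSpacePt m → F} (hh : Differentiable ℝ h) {A : ℝ}
    (hA : ∀ x, ‖fderiv ℝ h x‖ ≤ A)
    (hint : IntegrableOn (fun y : HalfSpacePt m => y.2 * |b y|) (halfSpace m))
    (x : HalfSpacePt m) :
    ‖dipole m b h x‖ ≤ 2 * A * ∫ y in halfSpace m, y.2 * |b y| := by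
  rw [← integral_const_mul]
  refine norm_integral_le_of_norm_le (hint.const_mul _) ?_
  filter_upwards [ae_restrict_mem (measurableSet_halfSpace m)] with y hy
  exact norm_smul_sub_reflectPt_le hh hA x hy

theorem hasFDerivAt_dipole {h : HalfSpacePt m → F} (hh : ContDiff ℝ 2 h) {A A' : ℝ}
    (hA : ∀ x, ‖fderiv ℝ h x‖ ≤ A) (hA' : ∀ x, ‖fderiv ℝ (fderiv ℝ h) x‖ ≤ A')
    (hb : Measurable b)
    (hint : IntegrableOn (fun y : HalfSpacePt m => y.2 * |b y|) (halfSpace m))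
    (x : HalfSpacePt m) :
    HasFDerivAt (dipole m b h) (dipole m b (fderiv ℝ h) x) x := by
  have hd : Differentiable ℝ h := hh.differentiable (by norm_num)
  have hd1 : ContDiff ℝ 1 (fderiv ℝ h) := hh.fderiv_right (by norm_num)
  have hd' : Differentiable ℝ (fderiv ℝ h) := hd1.differentiable (by norm_num)
  refine hasFDerivAt_integral_of_dominated_of_fderiv_le (s := Set.univ)
    (F := fun x y => b y • (h (x - y) - h (x - reflectPt m y)))
    (F' := fun x y => b y • (fderiv ℝ h (x - y) - fderiv ℝ h (x - reflectPt m y)))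
    (bound := fun y => 2 * A' * (y.2 * |b y|)) Filter.univ_mem
    (.of_forall fun x => aestronglyMeasurable_smul_sub_reflectPt hd.continuous hb x _) ?_
    (aestronglyMeasurable_smul_sub_reflectPt hd1.continuous hb x _) ?_ (hint.const_mul _) ?_
  · refine (hint.const_mul (2 * A)).mono'
      (aestronglyMeasurable_smul_sub_reflectPt hd.continuous hb x _) ?_
    filter_upwards [ae_restrict_mem (measurableSet_halfSpace m)] with y hy
    exact norm_smul_sub_reflectPt_le hd hA x hy
  · filter_upwards [ae_restrict_mem (measurableSet_halfSpace m)] with y hy x _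
    exact norm_smul_sub_reflectPt_le hd' hA' x hy
  · refine .of_forall fun y x _ => ?_
    have aux (c : HalfSpacePt m) :
        HasFDerivAt (fun x => h (x - c)) (fderiv ℝ h (x - c)) x :=
      (hasFDerivAt_comp_sub (f := h) c).2 (hd _).hasFDerivAt
    exact ((aux y).sub (aux (reflectPt m y))).const_smul (b y)

end Dipole

theorem lintegral_enorm_add_right_sub_le {E F : Type*} [NormedAddCommGroup E] [NormedSpace ℝ E]
    [FiniteDimensional ℝ E] [MeasurableSpace E] [BorelSpace E] [NormedAddCommGroup F]
    [NormedSpace ℝ F] (μ : Measure E) [SFinite μ] [μ.IsAddRightInvariant]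
    {h : E → F} (hh : ContDiff ℝ 1 h) (u : E) :
    ∫⁻ x, ‖h (x + u) - h x‖ₑ ∂μ ≤ ‖u‖ₑ * ∫⁻ x, ‖fderiv ℝ h x‖ₑ ∂μ := by
  have hc : Continuous (fderiv ℝ h) := hh.continuous_fderiv (by norm_num)
  have hd : Differentiable ℝ h := hh.differentiable (by norm_num)
  calc ∫⁻ x, ‖h (x + u) - h x‖ₑ ∂μ
      ≤ ∫⁻ x, (∫⁻ s in Set.Icc (0 : ℝ) 1, ‖fderiv ℝ h (x + s • u)‖ₑ * ‖u‖ₑ) ∂μ := by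
        refine lintegral_mono fun x => ?_
        have hcd : ContDiff ℝ 1 fun s : ℝ => h (x + s • u) := by fun_prop
        have := enorm_sub_le_lintegral_deriv_of_contDiffOn_Icc hcd.contDiffOn zero_le_one
        simp only [one_smul, zero_smul, add_zero] at this
        refine this.trans (lintegral_mono fun s => ?_)
        have hderiv : HasDerivAt (fun s : ℝ => h (x + s • u)) (fderiv ℝ h (x + s • u) u) s := by
          have h1 : HasDerivAt (fun s : ℝ => x + s • u) u s := by
            simpa using ((hasDerivAt_id s).smul_const u).const_add x
          exact (hd _).hasFDerivAt.comp_hasDerivAt s h1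
        rw [hderiv.deriv]
        exact ContinuousLinearMap.le_opENorm _ _
    _ = ∫⁻ s in Set.Icc (0 : ℝ) 1, ∫⁻ x, ‖fderiv ℝ h (x + s • u)‖ₑ * ‖u‖ₑ ∂μ := by
        refine lintegral_lintegral_swap ?_
        refine Measurable.aemeasurable ?_
        refine Measurable.mul_const ?_ _
        exact Continuous.measurable (by fun_prop)
    _ = ∫⁻ s in Set.Icc (0 : ℝ) 1, ‖u‖ₑ * ∫⁻ x, ‖fderiv ℝ h x‖ₑ ∂μ := by
        refine lintegral_congr fun s => ?_
        rw [lintegral_mul_const' _ _ enorm_ne_top, mul_comm,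
          lintegral_add_right_eq_self (fun x => ‖fderiv ℝ h x‖ₑ)]
    _ = ‖u‖ₑ * ∫⁻ x, ‖fderiv ℝ h x‖ₑ ∂μ := by simp

theorem lintegral_enorm_dipole_le {F : Type*} [NormedAddCommGroup F] [NormedSpace ℝ F]
    {m : ℕ} {b : HalfSpacePt m → ℝ} (hb : Measurable b) {h : HalfSpacePt m → F}
    (hh : ContDiff ℝ 1 h) :
    ∫⁻ x, ‖dipole m b h x‖ₑ ≤ 2 * (∫⁻ x, ‖fderiv ℝ h x‖ₑ) *
      ∫⁻ y in halfSpace m, ENNReal.ofReal (y.2 * |b y|) := by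
  have hr := continuous_reflectPt m
  have hc := hh.continuous
  calc ∫⁻ x, ‖dipole m b h x‖ₑ
      ≤ ∫⁻ x, ∫⁻ y in halfSpace m, ‖b y‖ₑ * ‖h (x - y) - h (x - reflectPt m y)‖ₑ := by
        refine lintegral_mono fun x => ?_
        refine (enorm_integral_le_lintegral_enorm _).trans_eq ?_
        simp_rw [enorm_smul]
    _ = ∫⁻ y in halfSpace m, ∫⁻ x, ‖b y‖ₑ * ‖h (x - y) - h (x - reflectPt m y)‖ₑ := by
        refine lintegral_lintegral_swap (Measurable.aemeasurable ?_)
        refine Measurable.mul (hb.enorm.comp measurable_snd) ?_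
        exact Continuous.measurable (by fun_prop)
    _ ≤ ∫⁻ y in halfSpace m, (2 * ∫⁻ x, ‖fderiv ℝ h x‖ₑ) * ENNReal.ofReal (y.2 * |b y|) := by
        refine setLIntegral_mono' (measurableSet_halfSpace m) fun y hy => ?_
        have hy' : 0 < y.2 := hy
        rw [lintegral_const_mul' _ _ enorm_ne_top]
        have h1 := lintegral_enorm_add_right_sub_le volume hh (reflectPt m y - y)
        rw [← lintegral_sub_right_eq_self _ (reflectPt m y)] at h1
        simp only [sub_add_sub_cancel] at h1
        rw [← ofReal_norm (reflectPt m y - y), norm_reflectPt_sub m hy] at h1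
        calc _ ≤ ‖b y‖ₑ * (ENNReal.ofReal (2 * y.2) * ∫⁻ x, ‖fderiv ℝ h x‖ₑ) := by gcongr
          _ = _ := by
            rw [ENNReal.ofReal_mul hy'.le, ENNReal.ofReal_mul zero_le_two,
              Real.enorm_eq_ofReal_abs, ENNReal.ofReal_ofNat]
            ring
    _ = _ := by
        rw [lintegral_const_mul _ (by fun_prop)]

theorem Eheat_eq_dipole (m : ℕ) (t : ℝ) (b : HalfSpacePt m → ℝ) :
    Eheat m t b = dipole m b (gauss m t) := by
  funext x
  refine integral_congr_ae (.of_forall fun y => ?_)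
  simp only [smul_eq_mul, reflectPt, mul_comm (b y)]
  congr 3
  ext <;> simp

/-! ### Decay of the derivatives of the Gauss kernel -/

theorem exists_one_add_pow_mul_exp_neg_sq_le (k : ℕ) :
    ∃ C : ℝ, ∀ r : ℝ, 0 ≤ r → (1 + r) ^ k * Real.exp (-r ^ 2 / 4) ≤ C := by
  refine ⟨k.factorial * Real.exp 2, fun r hr => ?_⟩
  have h1 := Real.pow_div_factorial_le_exp (1 + r) (by positivity) k
  rw [div_le_iff₀ (by positivity)] at h1
  calc (1 + r) ^ k * Real.exp (-r ^ 2 / 4)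
      ≤ (Real.exp (1 + r) * k.factorial) * Real.exp (-r ^ 2 / 4) := by gcongr
    _ = k.factorial * Real.exp (1 + r + -r ^ 2 / 4) := by rw [Real.exp_add (1 + r)]; ring
    _ ≤ k.factorial * Real.exp 2 := by
        gcongr
        nlinarith [sq_nonneg (r - 2)]

theorem norm_sq_le_sum_sq_add_sq {m : ℕ} (x : HalfSpacePt m) :
    ‖x‖ ^ 2 ≤ (∑ i, x.1 i ^ 2) + x.2 ^ 2 := by
  have hs : 0 ≤ ∑ i, x.1 i ^ 2 := Finset.sum_nonneg fun i _ => sq_nonneg _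
  refine (Real.le_sqrt (norm_nonneg x) (by positivity)).1 ?_
  rw [Prod.norm_def]
  refine max_le ?_ ?_
  · refine (pi_norm_le_iff_of_nonneg (Real.sqrt_nonneg _)).2 fun i => Real.le_sqrt_of_sq_le ?_
    rw [Real.norm_eq_abs, sq_abs]
    have := Finset.single_le_sum (f := fun i => x.1 i ^ 2) (fun i _ => sq_nonneg _)
      (Finset.mem_univ i)
    nlinarith [sq_nonneg x.2]
  · refine Real.le_sqrt_of_sq_le ?_
    rw [Real.norm_eq_abs, sq_abs]
    linarith

theorem contDiff_gauss (m : ℕ) (t : ℝ) {n : WithTop ℕ∞} : ContDiff ℝ n (gauss m t) := by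
  unfold gauss
  fun_prop

theorem hasTemperateGrowth_quadratic (m : ℕ) :
    (fun x : HalfSpacePt m => -((∑ i, x.1 i ^ 2) + x.2 ^ 2) / 4).HasTemperateGrowth := by
  have h1 (i : Fin m) : (fun x : HalfSpacePt m => x.1 i).HasTemperateGrowth :=
    ((ContinuousLinearMap.proj (R := ℝ) (φ := fun _ : Fin m => ℝ) i).comp
      (ContinuousLinearMap.fst ℝ (Fin m → ℝ) ℝ)).hasTemperateGrowth
  have h2 : (fun x : HalfSpacePt m => x.2).HasTemperateGrowth :=
    (ContinuousLinearMap.snd ℝ (Fin m → ℝ) ℝ).hasTemperateGrowth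
  have h3 : (fun x : HalfSpacePt m => ∑ i, x.1 i ^ 2).HasTemperateGrowth :=
    .sum fun i _ => (h1 i).pow 2
  have h4 := ((h3.add (h2.pow 2)).neg).mul (.const (1 / 4))
  have heq : (fun x : HalfSpacePt m => -((∑ i, x.1 i ^ 2) + x.2 ^ 2) / 4) =
      fun x => -((∑ i, x.1 i ^ 2) + x.2 ^ 2) * (1 / 4) := by
    funext x
    ring
  rw [heq]
  exact h4

theorem exists_norm_iteratedFDeriv_gauss_one_le (m n k : ℕ) :
    ∃ C : ℝ, ∀ x : HalfSpacePt m,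
      (1 + ‖x‖) ^ k * ‖iteratedFDeriv ℝ n (gauss m 1) x‖ ≤ C := by
  set f : HalfSpacePt m → ℝ := fun x => -((∑ i, x.1 i ^ 2) + x.2 ^ 2) / 4
  set c : ℝ := (4 * Real.pi * 1) ^ (-((m : ℝ) + 1) / 2)
  have hc : 0 ≤ c := by positivity
  have hg : gauss m 1 = fun x => c • (Real.exp ∘ f) x := by
    funext x
    simp [gauss, c, f]
  have hf : f.HasTemperateGrowth := hasTemperateGrowth_quadratic m
  obtain ⟨l, M, hM, hbd⟩ := hf.norm_iteratedFDeriv_le_uniform n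
  obtain ⟨C, hC⟩ := exists_one_add_pow_mul_exp_neg_sq_le (k + l * n)
  refine ⟨c * n.factorial * (M + 1) ^ n * C, fun x => ?_⟩
  have hexp : ∀ i, ‖iteratedFDeriv ℝ i Real.exp (f x)‖ = Real.exp (f x) := by
    intro i
    rw [norm_iteratedFDeriv_eq_norm_iteratedDeriv, iteratedDeriv_eq_iterate, Real.iter_deriv_exp]
    simp
  have h1 : ∀ i, 1 ≤ i → i ≤ n → ‖iteratedFDeriv ℝ i f x‖ ≤ ((M + 1) * (1 + ‖x‖) ^ l) ^ i := by
    intro i hi hin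
    have hone : 1 ≤ (M + 1) * (1 + ‖x‖) ^ l :=
      one_le_mul_of_one_le_of_one_le (by linarith)
        (one_le_pow₀ (by linarith [norm_nonneg x]))
    calc _ ≤ M * (1 + ‖x‖) ^ l := hbd i hin x
      _ ≤ (M + 1) * (1 + ‖x‖) ^ l := by gcongr; linarith
      _ ≤ _ := le_self_pow₀ hone (by omega)
  have h2 := norm_iteratedFDeriv_comp_le (N := n) Real.contDiff_exp
    (hf.1.of_le (by exact_mod_cast le_top)) le_rfl x (fun i _ => (hexp i).le) h1
  rw [hg, iteratedFDeriv_const_smul_apply' (by fun_prop), norm_smul, Real.norm_of_nonneg hc]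
  have h3 : Real.exp (f x) ≤ Real.exp (-‖x‖ ^ 2 / 4) := by
    gcongr
    have := norm_sq_le_sum_sq_add_sq x
    simp only [f]
    linarith
  calc (1 + ‖x‖) ^ k * (c * ‖iteratedFDeriv ℝ n (Real.exp ∘ f) x‖)
      ≤ (1 + ‖x‖) ^ k * (c * (n.factorial * Real.exp (-‖x‖ ^ 2 / 4) *
          ((M + 1) * (1 + ‖x‖) ^ l) ^ n)) := by
        gcongr
        exact h2.trans (by gcongr)
    _ = c * n.factorial * (M + 1) ^ n *
          ((1 + ‖x‖) ^ (k + l * n) * Real.exp (-‖x‖ ^ 2 / 4)) := by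
        rw [mul_pow, ← pow_mul, pow_add]; ring
    _ ≤ _ := by
        gcongr
        exact hC _ (norm_nonneg x)

theorem exists_norm_iteratedFDeriv_gauss_one_bounds (m n : ℕ) :
    (∃ A, ∀ x, ‖iteratedFDeriv ℝ n (gauss m 1) x‖ ≤ A) ∧
      ∫⁻ x, ‖iteratedFDeriv ℝ n (gauss m 1) x‖ₑ < ⊤ := by
  constructor
  · simpa using exists_norm_iteratedFDeriv_gauss_one_le m n 0
  · obtain ⟨C, hC⟩ := exists_norm_iteratedFDeriv_gauss_one_le m n (m + 2)
    have hdim : (Module.finrank ℝ (HalfSpacePt m) : ℝ) < ((m + 2 : ℕ) : ℝ) := by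
      simp
    have hint := (integrable_one_add_norm
      (μ := (volume : Measure (HalfSpacePt m))) hdim).const_mul C
    refine lt_of_le_of_lt (lintegral_mono fun x => ?_) hint.2
    refine enorm_le_iff_norm_le.2 (le_trans ?_ (Real.le_norm_self _))
    beta_reduce
    rw [Real.rpow_neg (by positivity), Real.rpow_natCast, ← div_eq_mul_inv,
      le_div_iff₀ (by positivity), mul_comm]
    exact hC x

theorem fderiv_smul_comp_smul {E F : Type*} [NormedAddCommGroup E] [NormedSpace ℝ E]
    [NormedAddCommGroup F] [NormedSpace ℝ F] {h : E → F} (hh : Differentiable ℝ h) (c r : ℝ) :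
    fderiv ℝ (fun x => c • h (r • x)) = fun x => (c * r) • fderiv ℝ h (r • x) := by
  funext x
  rw [fderiv_fun_const_smul (by fun_prop), fderiv_comp_smul, smul_smul]

theorem gauss_eq_scaled (m : ℕ) {t : ℝ} (ht : 0 < t) :
    gauss m t = fun x => (t ^ (-(1 / 2) : ℝ)) ^ (m + 1) •
      gauss m 1 (t ^ (-(1 / 2) : ℝ) • x) := by
  funext x
  have hr : (t ^ (-(1 / 2) : ℝ)) ^ 2 = t⁻¹ := by
    rw [← Real.rpow_natCast, ← Real.rpow_mul ht.le, ← Real.rpow_neg_one]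
    norm_num
  have hs : (t ^ (-(1 / 2) : ℝ)) ^ (m + 1) = t ^ (-((m : ℝ) + 1) / 2) := by
    rw [← Real.rpow_natCast, ← Real.rpow_mul ht.le]
    congr 1
    push_cast
    ring
  simp only [gauss, Prod.smul_fst, Prod.smul_snd, Pi.smul_apply, smul_eq_mul, mul_pow,
    ← Finset.mul_sum, ← mul_add, hr, hs, mul_one]
  rw [Real.mul_rpow (by positivity) ht.le]
  have : -(t⁻¹ * (∑ i, x.1 i ^ 2 + x.2 ^ 2)) / 4 = -(∑ i, x.1 i ^ 2 + x.2 ^ 2) / (4 * t) := by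
    field_simp
  rw [this]
  ring

theorem norm_fderiv_fderiv_fderiv_eq {E F : Type*} [NormedAddCommGroup E] [NormedSpace ℝ E]
    [NormedAddCommGroup F] [NormedSpace ℝ F] (h : E → F) (x : E) :
    ‖fderiv ℝ (fderiv ℝ (fderiv ℝ h)) x‖ = ‖iteratedFDeriv ℝ 3 h x‖ := by
  rw [← norm_iteratedFDeriv_fderiv, ← norm_iteratedFDeriv_fderiv, norm_iteratedFDeriv_one]

theorem lintegral_enorm_comp_smul {E F : Type*} [NormedAddCommGroup E] [NormedSpace ℝ E]
    [FiniteDimensional ℝ E] [MeasurableSpace E] [BorelSpace E] [NormedAddCommGroup F]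
    (μ : Measure E) [μ.IsAddHaarMeasure] (h : E → F) {r : ℝ} (hr : 0 < r) :
    ENNReal.ofReal (r ^ Module.finrank ℝ E) * ∫⁻ x, ‖h (r • x)‖ₑ ∂μ = ∫⁻ x, ‖h x‖ₑ ∂μ := by
  have e : MeasurableEmbedding (fun x : E => r • x) :=
    (Homeomorph.smulOfNeZero r hr.ne').measurableEmbedding
  rw [← e.lintegral_map (fun x => ‖h x‖ₑ), Measure.map_addHaar_smul μ hr.ne',
    lintegral_smul_measure, smul_eq_mul, ← mul_assoc, ← ENNReal.ofReal_mul (by positivity),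
    abs_of_pos (by positivity), mul_inv_cancel₀ (by positivity), ENNReal.ofReal_one, one_mul]

theorem exists_norm_fderiv_gauss_le (m : ℕ) {t : ℝ} (ht : 0 < t) :
    (∃ A, ∀ x, ‖fderiv ℝ (gauss m t) x‖ ≤ A) ∧
      ∃ A, ∀ x, ‖fderiv ℝ (fderiv ℝ (gauss m t)) x‖ ≤ A := by
  have hd : Differentiable ℝ (gauss m 1) := (contDiff_gauss m 1 (n := 1)).differentiable (by simp)
  have hd1 : Differentiable ℝ (fderiv ℝ (gauss m 1)) :=
    ((contDiff_gauss m 1 (n := 2)).fderiv_right (m := 1) (by norm_num)).differentiable (by simp)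
  obtain ⟨A, hA⟩ := (exists_norm_iteratedFDeriv_gauss_one_bounds m 1).1
  obtain ⟨A', hA'⟩ := (exists_norm_iteratedFDeriv_gauss_one_bounds m 2).1
  simp only [norm_iteratedFDeriv_one] at hA
  have hA'' x : ‖fderiv ℝ (fderiv ℝ (gauss m 1)) x‖ ≤ A' := by
    rw [← norm_iteratedFDeriv_one, norm_iteratedFDeriv_fderiv]
    exact hA' x
  rw [gauss_eq_scaled m ht, fderiv_smul_comp_smul hd, fderiv_smul_comp_smul hd1]
  simp only [norm_smul]
  exact ⟨⟨_, fun x => mul_le_mul_of_nonneg_left (hA _) (norm_nonneg _)⟩,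
    ⟨_, fun x => mul_le_mul_of_nonneg_left (hA'' _) (norm_nonneg _)⟩⟩

theorem exists_thirdDeriv_gauss_bounds (m : ℕ) :
    ∃ A : ℝ, 0 ≤ A ∧ ∀ t : ℝ, 0 < t →
      (∀ x, ‖fderiv ℝ (fderiv ℝ (fderiv ℝ (gauss m t))) x‖ ≤
        A * (t ^ (-(1 / 2) : ℝ)) ^ 3 * (t ^ (-(1 / 2) : ℝ)) ^ (m + 1)) ∧
      ∫⁻ x, ‖fderiv ℝ (fderiv ℝ (fderiv ℝ (gauss m t))) x‖ₑ ≤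
        ENNReal.ofReal (A * (t ^ (-(1 / 2) : ℝ)) ^ 3) := by
  have hd : Differentiable ℝ (gauss m 1) := (contDiff_gauss m 1 (n := 1)).differentiable (by simp)
  have hc1 : ContDiff ℝ 2 (fderiv ℝ (gauss m 1)) :=
    (contDiff_gauss m 1 (n := 3)).fderiv_right (by norm_num)
  have hd1 : Differentiable ℝ (fderiv ℝ (gauss m 1)) := hc1.differentiable (by simp)
  have hd2 : Differentiable ℝ (fderiv ℝ (fderiv ℝ (gauss m 1))) :=
    (hc1.fderiv_right (m := 1) (by norm_num)).differentiable (by simp)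
  obtain ⟨⟨A, hA⟩, hI⟩ := exists_norm_iteratedFDeriv_gauss_one_bounds m 3
  set I := ∫⁻ x, ‖iteratedFDeriv ℝ 3 (gauss m 1) x‖ₑ with hIdef
  refine ⟨max A I.toReal, le_max_of_le_right ENNReal.toReal_nonneg, fun t ht => ?_⟩
  set r := t ^ (-(1 / 2) : ℝ) with hr
  have hr0 : 0 < r := by positivity
  rw [gauss_eq_scaled m ht, ← hr, fderiv_smul_comp_smul hd, fderiv_smul_comp_smul hd1,
    fderiv_smul_comp_smul hd2]
  have hn (x : HalfSpacePt m) : ‖(r ^ (m + 1) * r * r * r) •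
      fderiv ℝ (fderiv ℝ (fderiv ℝ (gauss m 1))) (r • x)‖ =
      r ^ 3 * r ^ (m + 1) * ‖iteratedFDeriv ℝ 3 (gauss m 1) (r • x)‖ := by
    rw [norm_smul, norm_fderiv_fderiv_fderiv_eq, Real.norm_of_nonneg (by positivity)]
    ring
  constructor
  · intro x
    rw [hn]
    calc _ ≤ r ^ 3 * r ^ (m + 1) * max A I.toReal := by
          gcongr
          exact (hA _).trans (le_max_left _ _)
      _ = _ := by ring
  · have hfin : Module.finrank ℝ (HalfSpacePt m) = m + 1 := by simp
    have hscale := lintegral_enorm_comp_smul volume (iteratedFDeriv ℝ 3 (gauss m 1)) hr0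
    rw [hfin] at hscale
    have he (x : HalfSpacePt m) : ‖(r ^ (m + 1) * r * r * r) •
        fderiv ℝ (fderiv ℝ (fderiv ℝ (gauss m 1))) (r • x)‖ₑ =
        ENNReal.ofReal (r ^ 3) * (ENNReal.ofReal (r ^ (m + 1)) *
          ‖iteratedFDeriv ℝ 3 (gauss m 1) (r • x)‖ₑ) := by
      rw [← ofReal_norm, hn, ENNReal.ofReal_mul (by positivity), ENNReal.ofReal_mul (by positivity),
        ofReal_norm, mul_assoc]
    simp only [he]
    rw [lintegral_const_mul' _ _ ENNReal.ofReal_ne_top,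
      lintegral_const_mul' _ _ ENNReal.ofReal_ne_top, hscale, mul_comm,
      ENNReal.ofReal_mul (le_max_of_le_right ENNReal.toReal_nonneg)]
    gcongr
    rw [← hIdef, ← ENNReal.ofReal_toReal hI.ne]
    exact ENNReal.ofReal_le_ofReal (by simp)

/-- Interpolation between an `L¹` bound and an `L^∞` bound. -/
theorem eLpNorm_le_of_norm_le_of_lintegral_enorm_le {α E : Type*} [MeasurableSpace α]
    [NormedAddCommGroup E] {μ : Measure α} {f : α → E} {K s : ℝ} (hK : 0 ≤ K) (hs : 0 ≤ s)
    (hf : ∀ x, ‖f x‖ ≤ K * s) (hf' : ∫⁻ x, ‖f x‖ₑ ∂μ ≤ ENNReal.ofReal K)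
    {q : ℝ≥0∞} (hq : 1 ≤ q) :
    eLpNorm f q μ ≤ ENNReal.ofReal (K * s ^ (1 - q⁻¹.toReal)) := by
  rcases eq_or_ne q ⊤ with rfl | hq'
  · simpa using eLpNormEssSup_le_of_ae_bound (μ := μ) (.of_forall hf)
  set p := q.toReal with hp
  have hp1 : 1 ≤ p := (ENNReal.ofReal_le_iff_le_toReal hq').1 (by simpa using hq)
  have hq0 : q ≠ 0 := (zero_lt_one.trans_le hq).ne'
  rw [eLpNorm_eq_lintegral_rpow_enorm_toReal hq0 hq', ← hp, ENNReal.toReal_inv, ← hp]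
  have h1 : ∫⁻ x, ‖f x‖ₑ ^ p ∂μ ≤ ENNReal.ofReal ((K * s) ^ (p - 1) * K) := by
    calc ∫⁻ x, ‖f x‖ₑ ^ p ∂μ
        ≤ ∫⁻ x, ENNReal.ofReal ((K * s) ^ (p - 1)) * ‖f x‖ₑ ∂μ := by
          refine lintegral_mono fun x => ?_
          calc ‖f x‖ₑ ^ p = ‖f x‖ₑ ^ (p - 1) * ‖f x‖ₑ := by
                conv_rhs => rw [← ENNReal.rpow_one ‖f x‖ₑ, ← ENNReal.rpow_mul,
                  ← ENNReal.rpow_add_of_nonneg _ _ (by linarith) zero_le_one]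
                ring_nf
            _ ≤ _ := by
                rw [← ENNReal.ofReal_rpow_of_nonneg (by positivity) (by linarith), ← ofReal_norm]
                gcongr
                exact hf x
      _ ≤ _ := by
          rw [lintegral_const_mul' _ _ ENNReal.ofReal_ne_top, ENNReal.ofReal_mul (by positivity)]
          gcongr
  calc (∫⁻ x, ‖f x‖ₑ ^ p ∂μ) ^ (1 / p)
      ≤ ENNReal.ofReal ((K * s) ^ (p - 1) * K) ^ (1 / p) := by gcongr
    _ = ENNReal.ofReal (K * s ^ (1 - p⁻¹)) := by
        rw [ENNReal.ofReal_rpow_of_nonneg (by positivity) (by positivity)]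
        congr 1
        have h2 : (K * s) ^ (p - 1) * K = K ^ p * s ^ (p - 1) := by
          rw [Real.mul_rpow hK hs, mul_right_comm]
          nth_rw 2 [← Real.rpow_one K]
          rw [← Real.rpow_add_of_nonneg hK (by linarith) zero_le_one, sub_add_cancel]
        rw [h2, Real.mul_rpow (by positivity) (by positivity), ← Real.rpow_mul hK,
          ← Real.rpow_mul hs]
        have hp0 : p ≠ 0 := by positivity
        congr 1
        · rw [mul_one_div_cancel hp0, Real.rpow_one]
        · congr 1
          field_simp

theorem norm_coordVec_le_one (m : ℕ) (i : Fin (m + 1)) : ‖coordVec m i‖ ≤ 1 := by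
  unfold coordVec
  split_ifs with h
  · refine max_le ((pi_norm_le_iff_of_nonneg zero_le_one).2 fun j => ?_) (by simp)
    simp only [Pi.single_apply]
    split_ifs <;> simp
  · simp [Prod.norm_mk]

/-- for `1 ≤ q ≤ ∞` there is `C = C(n,q) > 0` such that for `t > 0` and
`b` measurable with `∫ yₙ|b| < ∞`, `E(t)b` is twice differentiable on `ℝⁿ₊` and all of
its second-order partial derivatives satisfy
`‖∂_i∂_j E(t)b‖_{L^q(ℝⁿ₊)} ≤ C t^{−3/2 − (n/2)(1 − 1/q)} ∫ yₙ|b(y)| dy` (`n = m + 1`). -/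
theorem Eheat_secondDeriv_Lq_decay (m : ℕ) (q : ℝ≥0∞) (hq : 1 ≤ q) :
    ∃ C : ℝ, 0 < C ∧ ∀ t : ℝ, 0 < t → ∀ b : HalfSpacePt m → ℝ, Measurable b →
      (∫⁻ y in halfSpace m, ENNReal.ofReal (y.2 * |b y|)) < ⊤ →
      (∀ x ∈ halfSpace m, DifferentiableAt ℝ (Eheat m t b) x ∧
        DifferentiableAt ℝ (fderiv ℝ (Eheat m t b)) x) ∧
      ∀ i j : Fin (m + 1),
        eLpNorm
          (fun x : HalfSpacePt m =>
            fderiv ℝ (fderiv ℝ (Eheat m t b)) x (coordVec m i) (coordVec m j))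
          q (volume.restrict (halfSpace m)) ≤
        ENNReal.ofReal
          (C * t ^ (-(3 : ℝ) / 2 - ((m : ℝ) + 1) / 2 * (1 - q⁻¹.toReal)) *
            ∫ y in halfSpace m, y.2 * |b y|) := by
  obtain ⟨A, hA, hbd⟩ := exists_thirdDeriv_gauss_bounds m
  refine ⟨2 * A + 1, by positivity, fun t ht b hb hfin => ?_⟩
  set r := t ^ (-(1 / 2) : ℝ) with hr
  have hr0 : 0 < r := by positivity
  obtain ⟨hsup, hL1⟩ := hbd t ht
  obtain ⟨⟨A₁, hA₁⟩, ⟨A₂, hA₂⟩⟩ := exists_norm_fderiv_gauss_le m ht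
  have hnn : 0 ≤ᵐ[volume.restrict (halfSpace m)] fun y : HalfSpacePt m => y.2 * |b y| := by
    filter_upwards [ae_restrict_mem (measurableSet_halfSpace m)] with y hy
    exact mul_nonneg (le_of_lt hy) (abs_nonneg _)
  have hint : IntegrableOn (fun y : HalfSpacePt m => y.2 * |b y|) (halfSpace m) :=
    ⟨Measurable.aestronglyMeasurable (by fun_prop), (hasFiniteIntegral_iff_ofReal hnn).2 hfin⟩
  set B := ∫ y in halfSpace m, y.2 * |b y| with hB
  have hB0 : 0 ≤ B := integral_nonneg_of_ae hnn
  have hBof : ∫⁻ y in halfSpace m, ENNReal.ofReal (y.2 * |b y|) = ENNReal.ofReal B :=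
    (ofReal_integral_eq_lintegral_ofReal hint hnn).symm
  have hc1 : ContDiff ℝ 2 (fderiv ℝ (gauss m t)) :=
    (contDiff_gauss m t (n := 3)).fderiv_right (by norm_num)
  have hc2 : ContDiff ℝ 1 (fderiv ℝ (fderiv ℝ (gauss m t))) := hc1.fderiv_right (by norm_num)
  have hD1 := hasFDerivAt_dipole (contDiff_gauss m t) hA₁ hA₂ hb hint
  have hD2 := hasFDerivAt_dipole hc1 hA₂ hsup hb hint
  have hE1 : fderiv ℝ (Eheat m t b) = dipole m b (fderiv ℝ (gauss m t)) := by
    rw [Eheat_eq_dipole]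
    exact funext fun x => (hD1 x).fderiv
  refine ⟨fun x _ => ⟨?_, ?_⟩, fun i j => ?_⟩
  · rw [Eheat_eq_dipole]
    exact (hD1 x).differentiableAt
  · rw [hE1]
    exact (hD2 x).differentiableAt
  have hle (x : HalfSpacePt m) :
      ‖fderiv ℝ (fderiv ℝ (Eheat m t b)) x (coordVec m i) (coordVec m j)‖ ≤
        ‖dipole m b (fderiv ℝ (fderiv ℝ (gauss m t))) x‖ := by
    rw [hE1, (hD2 x).fderiv]
    refine (ContinuousLinearMap.le_opNorm₂ _ _ _).trans ?_
    have h1 := norm_coordVec_le_one m i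
    have h2 := norm_coordVec_le_one m j
    calc _ ≤ ‖dipole m b (fderiv ℝ (fderiv ℝ (gauss m t))) x‖ * 1 * 1 := by gcongr
      _ = _ := by ring
  have key := eLpNorm_le_of_norm_le_of_lintegral_enorm_le (μ := volume.restrict (halfSpace m))
    (f := fun x => fderiv ℝ (fderiv ℝ (Eheat m t b)) x (coordVec m i) (coordVec m j))
    (K := 2 * A * r ^ 3 * B) (s := r ^ (m + 1)) (by positivity) (by positivity) ?_ ?_ hq
  · refine key.trans (ENNReal.ofReal_le_ofReal ?_)
    have hexp : t ^ (-(3 : ℝ) / 2 - ((m : ℝ) + 1) / 2 * (1 - q⁻¹.toReal)) =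
        r ^ 3 * (r ^ (m + 1)) ^ (1 - q⁻¹.toReal) := by
      rw [hr, ← Real.rpow_natCast, ← Real.rpow_natCast, ← Real.rpow_mul ht.le,
        ← Real.rpow_mul ht.le, ← Real.rpow_mul ht.le, ← Real.rpow_add ht]
      congr 1
      push_cast
      ring
    rw [hexp]
    calc 2 * A * r ^ 3 * B * (r ^ (m + 1)) ^ (1 - q⁻¹.toReal)
        = 2 * A * (r ^ 3 * (r ^ (m + 1)) ^ (1 - q⁻¹.toReal)) * B := by ring
      _ ≤ _ := by gcongr; linarith
  · intro x
    refine (hle x).trans ((norm_dipole_le (hc2.differentiable (by simp)) hsup hint x).trans_eq ?_)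
    ring
  · calc _ ≤ ∫⁻ x in halfSpace m, ‖dipole m b (fderiv ℝ (fderiv ℝ (gauss m t))) x‖ₑ := by
          refine lintegral_mono fun x => ?_
          rw [← ofReal_norm, ← ofReal_norm]
          exact ENNReal.ofReal_le_ofReal (hle x)
      _ ≤ ∫⁻ x, ‖dipole m b (fderiv ℝ (fderiv ℝ (gauss m t))) x‖ₑ := setLIntegral_le_lintegral _ _
      _ ≤ 2 * ENNReal.ofReal (A * r ^ 3) * ENNReal.ofReal B := by
          rw [← hBof]
          refine (lintegral_enorm_dipole_le hb hc2).trans ?_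
          gcongr
      _ = _ := by
          rw [mul_assoc 2, ← ENNReal.ofReal_mul (by positivity), ← ENNReal.ofReal_ofNat 2,
            ← ENNReal.ofReal_mul (by positivity)]
          congr 1
          ring

end
end

section
/- Let n ≥ 1 and 1 < r < ∞. There exists a constant C = C(n, r) > 0 such that for every t > 0 and every measurable function b : ℝⁿ₊ → ℝ with ∫_{ℝⁿ₊} yₙ |b(y)| dy < ∞ and ∫_{ℝⁿ₊} yₙ² |b(y)| dy < ∞, one has ‖xₙ E(t)b‖_{L^r(ℝⁿ₊)} ≤ C ( t^{−(n/2)(1 − 1/r)} ∫_{ℝⁿ₊} yₙ |b(y)| dy + t^{−1/2 − (n/2)(1 − 1/r)} ∫_{ℝⁿ₊} yₙ² |b(y)| dy ). -/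
open MeasureTheory ENNReal

noncomputable section

/-- The factor `1 - e^{-ab/t}` compensates the weight `a` up to a quadratic factor in `a - b`. -/
lemma mul_one_sub_exp_le {t a b : ℝ} (ht : 0 < t) (ha : 0 < a) (hb : 0 < b) :
    a * (1 - Real.exp (-(a * b) / t)) ≤ 2 * b * (1 + (a - b) ^ 2 / t) := by
  have h1 : 1 - Real.exp (-(a * b) / t) ≤ 1 := by linarith [Real.exp_pos (-(a * b) / t)]
  have h2 : 1 - Real.exp (-(a * b) / t) ≤ a * b / t := by
    have := Real.add_one_le_exp (-(a * b) / t)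
    rw [neg_div] at this ⊢
    linarith
  have e : 2 * b * (1 + (a - b) ^ 2 / t) = 2 * b * (t + (a - b) ^ 2) / t := by
    field_simp
  rw [e]
  rcases le_total (b ^ 2) t with h | h
  · refine (mul_le_mul_of_nonneg_left h2 ha.le).trans ?_
    rw [← mul_div_assoc]
    refine div_le_div_of_nonneg_right ?_ ht.le
    nlinarith [mul_nonneg hb.le (sq_nonneg (a - 2 * b)), mul_nonneg hb.le (sub_nonneg.2 h)]
  · refine (mul_le_mul_of_nonneg_left h1 ha.le).trans ?_
    rw [le_div_iff₀ ht]
    rcases le_total (a - b) b with h' | h'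
    · nlinarith [mul_nonneg hb.le (sq_nonneg (a - b)), mul_nonneg ht.le (sub_nonneg.2 h')]
    · have hd : 0 ≤ a - b := hb.le.trans h'
      nlinarith [mul_nonneg hd (sub_nonneg.2 h),
        mul_nonneg (mul_nonneg hd hb.le) (sub_nonneg.2 h'), mul_nonneg hb.le ht.le,
        mul_nonneg hb.le (sq_nonneg (a - b))]

lemma gauss_nonneg (m : ℕ) {t : ℝ} (ht : 0 < t) (x : HalfSpacePt m) : 0 ≤ gauss m t x := by
  unfold gauss; positivity

lemma measurable_gauss (m : ℕ) (t : ℝ) : Measurable (gauss m t) := by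
  unfold gauss; fun_prop

lemma gauss_le (m : ℕ) {t : ℝ} (ht : 0 < t) (x : HalfSpacePt m) :
    gauss m t x ≤ (4 * Real.pi * t) ^ (-((m : ℝ) + 1) / 2) := by
  unfold gauss
  refine mul_le_of_le_one_right (by positivity) (Real.exp_le_one_iff.2 ?_)
  rw [neg_div]
  have : 0 ≤ ∑ i, x.1 i ^ 2 := Finset.sum_nonneg fun i _ => sq_nonneg _
  exact neg_nonpos.2 (by positivity)

lemma lintegral_gauss (m : ℕ) {t : ℝ} (ht : 0 < t) :
    ∫⁻ x, ENNReal.ofReal (gauss m t x) = 1 := by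
  have hpos : 0 < 4 * Real.pi * t := by positivity
  let f : ℝ → ℝ := fun s => Real.exp (-(1 / (4 * t)) * s ^ 2)
  have hf : Integrable f := integrable_exp_neg_mul_sq (by positivity)
  have hfi : ∫ s, f s = Real.sqrt (4 * Real.pi * t) := by
    simp only [f, integral_gaussian]
    congr 1
    field_simp
  have hfac : gauss m t = fun x => (4 * Real.pi * t) ^ (-((m : ℝ) + 1) / 2) *
      ((∏ i, f (x.1 i)) * f x.2) := by
    funext x
    simp only [gauss, f]
    rw [← Real.exp_sum, ← Real.exp_add, ← Finset.mul_sum]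
    congr 2
    field_simp
    ring
  have hprod : Integrable (fun z : Fin m → ℝ => ∏ i, f (z i)) :=
    Integrable.fintype_prod (f := fun _ => f) fun _ => hf
  have hint : Integrable (gauss m t) := by
    rw [hfac]
    exact (hprod.mul_prod hf).const_mul _
  rw [← ofReal_integral_eq_lintegral_ofReal hint (.of_forall (gauss_nonneg m ht)), hfac,
    integral_const_mul, Measure.volume_eq_prod,
    integral_prod_mul (fun z : Fin m → ℝ => ∏ i, f (z i)) f,
    integral_fintype_prod_volume_eq_pow, hfi, Fintype.card_fin, ← pow_succ, Real.sqrt_eq_rpow,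
    ← Real.rpow_natCast, ← Real.rpow_mul hpos.le, ← Real.rpow_add hpos]
  simp only [Nat.cast_add, Nat.cast_one]
  ring_nf
  simp

/-- Values of the Gauss kernel at the reflected point. -/
lemma gauss_add_eq (m : ℕ) {t : ℝ} (ht : 0 < t) (z : Fin m → ℝ) (a b : ℝ) :
    gauss m t (z, a + b) = gauss m t (z, a - b) * Real.exp (-(a * b) / t) := by
  simp only [gauss]
  conv_rhs => rw [mul_assoc, ← Real.exp_add]
  congr 2
  field_simp
  ring

lemma gauss_add_le_gauss_sub (m : ℕ) {t a b : ℝ} (ht : 0 < t) (ha : 0 < a) (hb : 0 < b)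
    (z : Fin m → ℝ) : gauss m t (z, a + b) ≤ gauss m t (z, a - b) := by
  rw [gauss_add_eq m ht]
  refine mul_le_of_le_one_right (gauss_nonneg m ht _) (Real.exp_le_one_iff.2 ?_)
  rw [neg_div]
  exact neg_nonpos.2 (by positivity)

/-- Pointwise bound of the weighted Dirichlet heat kernel by a Gauss kernel. -/
lemma mul_dirichlet_kernel_le (m : ℕ) {t a b : ℝ} (ht : 0 < t) (ha : 0 < a) (hb : 0 < b)
    (z : Fin m → ℝ) :
    a * (gauss m t (z, a - b) - gauss m t (z, a + b)) ≤
      16 * 2 ^ (((m : ℝ) + 1) / 2) * gauss m (2 * t) (z, a - b) * b := by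
  have hS : 0 ≤ ∑ i, z i ^ 2 := Finset.sum_nonneg fun i _ => sq_nonneg _
  set q := Real.exp (-((∑ i, z i ^ 2) + (a - b) ^ 2) / (8 * t)) with hq
  set P := (4 * Real.pi * t) ^ (-((m : ℝ) + 1) / 2) with hP
  have hP0 : 0 < P := by positivity
  have hq0 : 0 < q := Real.exp_pos _
  have h1 : gauss m t (z, a - b) = P * (q * q) := by
    simp only [gauss]
    rw [hq, ← Real.exp_add, ← hP]
    congr 2
    field_simp
    ring
  have h2 : 2 ^ (((m : ℝ) + 1) / 2) * gauss m (2 * t) (z, a - b) = P * q := by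
    simp only [gauss]
    rw [show 4 * Real.pi * (2 * t) = 2 * (4 * Real.pi * t) by ring,
      Real.mul_rpow (by norm_num) (by positivity), ← hP, ← mul_assoc, ← mul_assoc,
      ← Real.rpow_add (by norm_num), hq]
    rw [show ((m : ℝ) + 1) / 2 + -((m : ℝ) + 1) / 2 = 0 by ring, Real.rpow_zero, one_mul,
      show 4 * (2 * t) = 8 * t by ring]
  have h3 : (1 + (a - b) ^ 2 / (8 * t)) * q ≤ 1 := by
    have h4 := Real.add_one_le_exp ((a - b) ^ 2 / (8 * t))
    have h5 : Real.exp ((a - b) ^ 2 / (8 * t)) * q ≤ 1 := by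
      rw [hq, ← Real.exp_add, Real.exp_le_one_iff]
      have : (a - b) ^ 2 / (8 * t) + -((∑ i, z i ^ 2) + (a - b) ^ 2) / (8 * t) =
        -((∑ i, z i ^ 2) / (8 * t)) := by ring
      rw [this]
      exact neg_nonpos.2 (by positivity)
    nlinarith
  have h6 := mul_one_sub_exp_le ht ha hb
  have h7 : 2 * b * (1 + (a - b) ^ 2 / t) ≤ 16 * b * (1 + (a - b) ^ 2 / (8 * t)) := by
    have : (a - b) ^ 2 / t = 8 * ((a - b) ^ 2 / (8 * t)) := by field_simp
    rw [this]
    nlinarith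
  have h8 : a * (1 - Real.exp (-(a * b) / t)) * q ≤ 16 * b := by
    nlinarith [mul_le_mul_of_nonneg_right (h6.trans h7) hq0.le,
      mul_le_mul_of_nonneg_left h3 (by positivity : 0 ≤ 16 * b)]
  rw [gauss_add_eq m ht, h1, mul_assoc 16, h2]
  calc a * (P * (q * q) - P * (q * q) * Real.exp (-(a * b) / t))
      = P * q * (a * (1 - Real.exp (-(a * b) / t)) * q) := by ring
    _ ≤ P * q * (16 * b) := by gcongr
    _ = 16 * (P * q) * b := by ring

/-- The `L^p` norm of a function bounded by `A` with integral at most `B`. -/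
lemma lintegral_rpow_le_of_le_of_lintegral_le {α : Type*} [MeasurableSpace α] {μ : Measure α}
    {h : α → ℝ≥0∞} {A B : ℝ≥0∞} {p : ℝ} (hp : 1 < p) (hA : ∀ x, h x ≤ A) (hA_top : A ≠ ⊤)
    (hB : ∫⁻ x, h x ∂μ ≤ B) : ∫⁻ x, h x ^ p ∂μ ≤ A ^ (p - 1) * B := by
  calc ∫⁻ x, h x ^ p ∂μ ≤ ∫⁻ x, A ^ (p - 1) * h x ∂μ := by
        refine lintegral_mono fun x => ?_
        have : h x ^ p = h x ^ (p - 1) * h x := by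
          conv_lhs => rw [show p = (p - 1) + 1 by ring]
          rw [ENNReal.rpow_add_of_nonneg _ _ (by linarith) zero_le_one, ENNReal.rpow_one]
        rw [this]
        gcongr
        exact hA x
    _ = A ^ (p - 1) * ∫⁻ x, h x ∂μ :=
        lintegral_const_mul' _ _ (ENNReal.rpow_ne_top_of_nonneg (by linarith) hA_top)
    _ ≤ A ^ (p - 1) * B := by gcongr

/-- The weighted Dirichlet heat operator is dominated by a Gaussian convolution. -/
lemma enorm_mul_Eheat_le (m : ℕ) {t : ℝ} (ht : 0 < t) (b : HalfSpacePt m → ℝ)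
    {x : HalfSpacePt m} (hx : x ∈ halfSpace m) :
    ‖x.2 * Eheat m t b x‖ₑ ≤
      ∫⁻ y in halfSpace m, ENNReal.ofReal (16 * 2 ^ (((m : ℝ) + 1) / 2)) *
        ENNReal.ofReal (gauss m (2 * t) (x - y)) * ENNReal.ofReal (y.2 * |b y|) := by
  have hH : MeasurableSet (halfSpace m) := measurableSet_lt measurable_const measurable_snd
  rw [Eheat, ← integral_const_mul]
  refine (enorm_integral_le_lintegral_enorm _).trans (setLIntegral_mono' hH fun y hy => ?_)
  have hx : 0 < x.2 := hx
  have hy : 0 < y.2 := hy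
  rw [← ENNReal.ofReal_mul (by positivity),
    ← ENNReal.ofReal_mul (mul_nonneg (by positivity) (gauss_nonneg m (by positivity) _)),
    ← ofReal_norm, ← mul_assoc, norm_mul, Real.norm_eq_abs, Real.norm_eq_abs,
    abs_of_nonneg (mul_nonneg hx.le (sub_nonneg.2 (gauss_add_le_gauss_sub m ht hx hy _))),
    ← mul_assoc]
  exact ENNReal.ofReal_le_ofReal
    (mul_le_mul_of_nonneg_right (mul_dirichlet_kernel_le m ht hx hy _) (abs_nonneg _))

/-- for `1 < r < ∞` there is `C = C(n,r) > 0` such that for `t > 0` and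
measurable `b` with finite first and second `yₙ`-moments,
`‖xₙ E(t)b‖_{L^r(ℝⁿ₊)} ≤ C (t^{−(n/2)(1−1/r)} ∫ yₙ|b| + t^{−1/2−(n/2)(1−1/r)} ∫ yₙ²|b|)`
(`n = m + 1`). -/
theorem xn_mul_Eheat_Lr_decay (m : ℕ) (r : ℝ≥0∞) (hr1 : 1 < r) (hr2 : r ≠ ⊤) :
    ∃ C : ℝ, 0 < C ∧ ∀ t : ℝ, 0 < t → ∀ b : HalfSpacePt m → ℝ, Measurable b →
      (∫⁻ y in halfSpace m, ENNReal.ofReal (y.2 * |b y|)) < ⊤ →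
      (∫⁻ y in halfSpace m, ENNReal.ofReal (y.2 ^ 2 * |b y|)) < ⊤ →
      eLpNorm (fun x : HalfSpacePt m => x.2 * Eheat m t b x) r
          (volume.restrict (halfSpace m)) ≤
        ENNReal.ofReal
          (C * (t ^ (-(((m : ℝ) + 1) / 2) * (1 - r⁻¹.toReal)) *
              (∫ y in halfSpace m, y.2 * |b y|) +
            t ^ (-(1 : ℝ) / 2 - ((m : ℝ) + 1) / 2 * (1 - r⁻¹.toReal)) *
              ∫ y in halfSpace m, y.2 ^ 2 * |b y|)) := by
  obtain ⟨D, hD⟩ : ∃ D : ℝ, D = 16 * 2 ^ (((m : ℝ) + 1) / 2) := ⟨_, rfl⟩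
  have hD0 : 0 < D := by rw [hD]; positivity
  refine ⟨D, hD0, fun t ht b hb hM _ => ?_⟩
  have hH : MeasurableSet (halfSpace m) := measurableSet_lt measurable_const measurable_snd
  set μ := (volume : Measure (HalfSpacePt m)).restrict (halfSpace m) with hμ
  set M := ∫ y, y.2 * |b y| ∂μ with hMdef
  have hw : Measurable fun y : HalfSpacePt m => y.2 * |b y| := by fun_prop
  have hw0 : 0 ≤ᵐ[μ] fun y : HalfSpacePt m => y.2 * |b y| :=
    (ae_restrict_mem hH).mono fun y hy => mul_nonneg (le_of_lt hy) (abs_nonneg _)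
  have hMeq : ∫⁻ y, ENNReal.ofReal (y.2 * |b y|) ∂μ = ENNReal.ofReal M :=
    (ofReal_integral_eq_lintegral_ofReal
      ⟨hw.aestronglyMeasurable, (hasFiniteIntegral_iff_ofReal hw0).2 hM⟩ hw0).symm
  have hM0 : 0 ≤ M := integral_nonneg_of_ae hw0
  set h : HalfSpacePt m → ℝ≥0∞ := fun x => ∫⁻ y, ENNReal.ofReal D *
        ENNReal.ofReal (gauss m (2 * t) (x - y)) * ENNReal.ofReal (y.2 * |b y|) ∂μ with hh
  set A : ℝ := t ^ (-((m : ℝ) + 1) / 2) with hA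
  have hA0 : 0 < A := Real.rpow_pos_of_pos ht _
  have hgA : ∀ x, gauss m (2 * t) x ≤ A := fun x => by
    refine (gauss_le m (by positivity) x).trans
      (Real.rpow_le_rpow_of_nonpos ht ?_ (by linarith [(m.cast_nonneg : (0 : ℝ) ≤ m)]))
    nlinarith [Real.pi_gt_three]
  have hsup : ∀ x, h x ≤ ENNReal.ofReal (D * A * M) := fun x => by
    calc h x ≤ ∫⁻ y, ENNReal.ofReal (D * A) * ENNReal.ofReal (y.2 * |b y|) ∂μ := by
          rw [ENNReal.ofReal_mul hD0.le]
          refine lintegral_mono fun y => ?_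
          gcongr
          exact hgA _
      _ = ENNReal.ofReal (D * A * M) := by
          rw [lintegral_const_mul' _ _ ENNReal.ofReal_ne_top, hMeq,
            ← ENNReal.ofReal_mul (by positivity)]
  have hone : ∫⁻ x, h x ∂μ ≤ ENNReal.ofReal (D * M) := by
    calc ∫⁻ x, h x ∂μ ≤ ∫⁻ x, h x := lintegral_mono' Measure.restrict_le_self le_rfl
      _ = ∫⁻ y, (∫⁻ x, ENNReal.ofReal D * ENNReal.ofReal (gauss m (2 * t) (x - y)) *
            ENNReal.ofReal (y.2 * |b y|)) ∂μ := by
          refine lintegral_lintegral_swap (Measurable.aemeasurable ?_)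
          have := measurable_gauss m (2 * t)
          unfold Function.uncurry
          fun_prop
      _ = ∫⁻ y, ENNReal.ofReal D * ENNReal.ofReal (y.2 * |b y|) ∂μ := by
          have : (volume : Measure (HalfSpacePt m)).IsAddLeftInvariant :=
            inferInstanceAs (Measure.prod volume volume).IsAddLeftInvariant
          refine lintegral_congr fun y => ?_
          rw [lintegral_mul_const' _ _ ENNReal.ofReal_ne_top,
            lintegral_const_mul' _ _ ENNReal.ofReal_ne_top,
            lintegral_sub_right_eq_self (fun x => ENNReal.ofReal (gauss m (2 * t) x)) y,
            lintegral_gauss m (by positivity), mul_one]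
      _ = ENNReal.ofReal (D * M) := by
          rw [lintegral_const_mul' _ _ ENNReal.ofReal_ne_top, hMeq, ← ENNReal.ofReal_mul hD0.le]
  have hr0 : r ≠ 0 := (zero_lt_one.trans hr1).ne'
  set p := r.toReal with hp
  have hp1 : 1 < p := by
    rw [hp, ← ENNReal.toReal_one]
    exact (ENNReal.toReal_lt_toReal ENNReal.one_ne_top hr2).2 hr1
  have hp0 : 0 < p := by linarith
  have hpow : ((D * A * M) ^ (p - 1) * (D * M)) ^ (1 / p) = D * A ^ (1 - p⁻¹) * M := by
    have : (D * A * M) ^ (p - 1) * (D * M) = A ^ (p - 1) * (D * M) ^ p := by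
      rw [show D * A * M = A * (D * M) by ring, Real.mul_rpow hA0.le (by positivity), mul_assoc]
      congr 1
      conv_rhs => rw [show p = (p - 1) + 1 by ring]
      rw [Real.rpow_add_one' (by positivity) (by linarith)]
    rw [this, Real.mul_rpow (by positivity) (by positivity), ← Real.rpow_mul hA0.le,
      ← Real.rpow_mul (by positivity : 0 ≤ D * M), mul_one_div_cancel hp0.ne', Real.rpow_one,
      show (p - 1) * (1 / p) = 1 - p⁻¹ by field_simp]
    ring
  calc eLpNorm (fun x : HalfSpacePt m => x.2 * Eheat m t b x) r μ
      = (∫⁻ x, ‖x.2 * Eheat m t b x‖ₑ ^ p ∂μ) ^ (1 / p) :=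
        eLpNorm_eq_lintegral_rpow_enorm_toReal hr0 hr2
    _ ≤ (∫⁻ x, h x ^ p ∂μ) ^ (1 / p) := by
        refine ENNReal.rpow_le_rpow (setLIntegral_mono' hH fun x hx => ?_) (by positivity)
        refine ENNReal.rpow_le_rpow ?_ hp0.le
        rw [hh, hD]
        exact enorm_mul_Eheat_le m ht b hx
    _ ≤ (ENNReal.ofReal (D * A * M) ^ (p - 1) * ENNReal.ofReal (D * M)) ^ (1 / p) :=
        ENNReal.rpow_le_rpow (lintegral_rpow_le_of_le_of_lintegral_le hp1 hsup
          ENNReal.ofReal_ne_top hone) (by positivity)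
    _ = ENNReal.ofReal (D * A ^ (1 - p⁻¹) * M) := by
        rw [ENNReal.ofReal_rpow_of_nonneg (by positivity) (by linarith),
          ← ENNReal.ofReal_mul (by positivity),
          ENNReal.ofReal_rpow_of_nonneg (by positivity) (by positivity), hpow]
    _ ≤ _ := by
        refine ENNReal.ofReal_le_ofReal ?_
        rw [hA, ← Real.rpow_mul ht.le, ENNReal.toReal_inv, ← hp, mul_assoc, neg_div]
        refine mul_le_mul_of_nonneg_left (le_add_of_nonneg_right ?_) hD0.le
        exact mul_nonneg (by positivity) (integral_nonneg_of_ae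
          (.of_forall fun y => mul_nonneg (sq_nonneg _) (abs_nonneg _)))

end
end
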